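/- arXiv:0809.1551 — 3 statements merged into one kernel-verified Lean document; each statement's English description precedes it below -/
import Mathlib

section
/- Existence of a repair with prescribed present and absent facts (Lemma 2 of the paper): For every instance I, every finite set of facts P with P ⊆ I, and every finite set of facts N with N ∩ I = ∅, there exists a repair I' of I such that P ⊆ I' and N ∩ I' = ∅ if and only if T*(P) is consistent and T*(P) ∩ N = ∅. -/
/-!
Setting: facts form a type `F` with decidable equality, instances are finite sets of facts.
`T` is a finite set of ground full TGD rules (body, head) with nonempty bodies,
`D` a finite set of ground denial rules (nonempty sets of facts).
-/

variable {F : Type*} [DecidableEq F]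

/-- An instance `J` is consistent: every TGD rule whose body is contained in `J`
has its head in `J`, and no denial rule is a subset of `J`. -/
def DBConsistent (T : Finset (Finset F × F)) (D : Finset (Finset F)) (J : Finset F) : Prop :=
  (∀ r ∈ T, r.1 ⊆ J → r.2 ∈ J) ∧ ∀ d ∈ D, ¬ d ⊆ J

/-- Symmetric difference `Δ(I,J) = (I∖J) ∪ (J∖I)` of two instances. -/
def DBDelta (I J : Finset F) : Finset F := (I \ J) ∪ (J \ I)

/-- `I'` is a repair of `I`: a consistent instance such that no consistent instance `J`
satisfies `Δ(I,J) ⊊ Δ(I,I')`. -/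
def DBRepair (T : Finset (Finset F × F)) (D : Finset (Finset F)) (I I' : Finset F) : Prop :=
  DBConsistent T D I' ∧ ¬ ∃ J : Finset F, DBConsistent T D J ∧ DBDelta I J ⊂ DBDelta I I'

/-- A set of facts is closed under the TGD rules of `T`. -/
def DBClosedSet (T : Finset (Finset F × F)) (K : Set F) : Prop :=
  ∀ r ∈ T, (↑r.1 : Set F) ⊆ K → r.2 ∈ K

/-- `T*(J)`: the smallest superset of `J` that contains the head of every TGD rule of `T`
whose body it contains. -/
def DBClosure (T : Finset (Finset F × F)) (J : Finset F) : Set F :=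
  ⋂₀ {K : Set F | (↑J : Set F) ⊆ K ∧ DBClosedSet T K}

/-- Consistency for an arbitrary set of facts. -/
def DBConsistentSet (T : Finset (Finset F × F)) (D : Finset (Finset F)) (K : Set F) : Prop :=
  DBClosedSet T K ∧ ∀ d ∈ D, ¬ (↑d : Set F) ⊆ K

theorem DBClosure_subset {T : Finset (Finset F × F)} {P : Finset F} {K : Set F}
    (hPK : (↑P : Set F) ⊆ K) (hK : DBClosedSet T K) : DBClosure T P ⊆ K :=
  Set.sInter_subset_of_mem ⟨hPK, hK⟩

theorem subset_DBClosure (T : Finset (Finset F × F)) (P : Finset F) :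
    (↑P : Set F) ⊆ DBClosure T P :=
  Set.subset_sInter fun _ hK => hK.1

theorem DBClosedSet_DBClosure (T : Finset (Finset F × F)) (P : Finset F) :
    DBClosedSet T (DBClosure T P) := fun r hr hsub =>
  Set.mem_sInter.2 fun _ hK => hK.2 r hr (hsub.trans (Set.sInter_subset_of_mem hK))

theorem DBClosure_finite (T : Finset (Finset F × F)) (P : Finset F) :
    (DBClosure T P).Finite := by
  refine (P ∪ T.image Prod.snd).finite_toSet.subset (DBClosure_subset ?_ ?_)
  · exact Finset.coe_subset.2 Finset.subset_union_left
  · intro r hr _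
    exact Finset.mem_coe.2 (Finset.mem_union_right _ (Finset.mem_image_of_mem _ hr))

theorem DBConsistentSet_coe {T : Finset (Finset F × F)} {D : Finset (Finset F)} {J : Finset F} :
    DBConsistentSet T D (↑J : Set F) ↔ DBConsistent T D J := by
  simp only [DBConsistentSet, DBClosedSet, DBConsistent, Finset.coe_subset, Finset.mem_coe]

/-- Below every consistent instance, in the order given by the difference to `I`, there is a
repair of `I`. -/
theorem exists_DBRepair_DBDelta_subset {T : Finset (Finset F × F)} {D : Finset (Finset F)}
    (I : Finset F) {K : Finset F} (hK : DBConsistent T D K) :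
    ∃ I' : Finset F, DBRepair T D I I' ∧ DBDelta I I' ⊆ DBDelta I K := by
  obtain ⟨J, ⟨hJ, hJK⟩, hmin⟩ :=
    (InvImage.wf (DBDelta I) (wellFounded_lt (α := Finset F))).has_min
      {J | DBConsistent T D J ∧ DBDelta I J ⊆ DBDelta I K} ⟨K, hK, Finset.Subset.refl _⟩
  refine ⟨J, ⟨hJ, ?_⟩, hJK⟩
  rintro ⟨L, hL, hLJ⟩
  exact hmin L ⟨hL, hLJ.subset.trans hJK⟩ hLJ

theorem inter_subset_of_DBDelta_subset {I J K : Finset F} (h : DBDelta I J ⊆ DBDelta I K) :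
    I ∩ K ⊆ J := by
  intro x hx
  have hx' := @h x
  simp only [DBDelta, Finset.mem_union, Finset.mem_sdiff, Finset.mem_inter] at hx hx'
  tauto

theorem subset_union_of_DBDelta_subset {I J K : Finset F} (h : DBDelta I J ⊆ DBDelta I K) :
    J ⊆ I ∪ K := by
  intro x hx
  have hx' := @h x
  simp only [DBDelta, Finset.mem_union, Finset.mem_sdiff] at hx' ⊢
  tauto

/-- Lemma 2: for `P ⊆ I` and `N ∩ I = ∅`, there exists a repair `I'` of `I` with
`P ⊆ I'` and `N ∩ I' = ∅` iff `T*(P)` is consistent and `T*(P) ∩ N = ∅`. -/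
theorem repair_with_prescribed_facts
    (T : Finset (Finset F × F)) (D : Finset (Finset F))
    (hT : ∀ r ∈ T, r.1.Nonempty) (hD : ∀ d ∈ D, d.Nonempty)
    (I P N : Finset F) (hP : P ⊆ I) (hN : N ∩ I = ∅) :
    (∃ I' : Finset F, DBRepair T D I I' ∧ P ⊆ I' ∧ N ∩ I' = ∅) ↔
      (DBConsistentSet T D (DBClosure T P) ∧ DBClosure T P ∩ (↑N : Set F) = ∅) := by
  constructor
  · rintro ⟨I', ⟨hI', -⟩, hPI', hNI'⟩
    obtain ⟨hclosed, hden⟩ := DBConsistentSet_coe.2 hI'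
    have hsub : DBClosure T P ⊆ ↑I' := DBClosure_subset (Finset.coe_subset.2 hPI') hclosed
    refine ⟨⟨DBClosedSet_DBClosure T P, fun d hd h => hden d hd (h.trans hsub)⟩, ?_⟩
    refine Set.eq_empty_of_forall_notMem fun x hx => ?_
    exact Finset.eq_empty_iff_forall_notMem.1 hNI' x (Finset.mem_inter.2 ⟨hx.2, hsub hx.1⟩)
  · rintro ⟨hcons, hdisj⟩
    obtain ⟨K, hK⟩ := (DBClosure_finite T P).exists_finset_coe
    have hPK : P ⊆ K := Finset.coe_subset.1 (hK ▸ subset_DBClosure T P)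
    rw [← hK] at hcons hdisj
    obtain ⟨I', hrep, hdelta⟩ := exists_DBRepair_DBDelta_subset I (DBConsistentSet_coe.1 hcons)
    refine ⟨I', hrep, (Finset.subset_inter hP hPK).trans
      (inter_subset_of_DBDelta_subset hdelta), Finset.eq_empty_of_forall_notMem fun x hx => ?_⟩
    obtain ⟨hxN, hxI'⟩ := Finset.mem_inter.1 hx
    rcases Finset.mem_union.1 (subset_union_of_DBDelta_subset hdelta hxI') with hxI | hxK
    · exact Finset.eq_empty_iff_forall_notMem.1 hN x (Finset.mem_inter.2 ⟨hxN, hxI⟩)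
    · exact Set.eq_empty_iff_forall_notMem.1 hdisj x ⟨hxK, hxN⟩
end

section
/- Correctness of blocks (Proposition 'block' of the paper): Assume the acyclicity assumption. Then for every instance I, every repair I' of I, and every fact p, we have p ∉ I' if and only if there exists a block (B,N) ∈ Block(p) with B ⊆ I' and N ∩ I' = ∅. -/
/-!
Setting: facts form a type `F` with decidable equality, instances are finite sets of facts.
`T` is a finite set of ground full TGD rules (body, head) with nonempty bodies,
`D` a finite set of ground denial rules (nonempty sets of facts).
Acyclicity: each fact carries a relation name `rel` and there is a rank `rk` on relation
names such that bodies of TGD rules use only relation names of strictly smaller rank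
than the head.
-/

variable {F : Type*} [DecidableEq F]

/-- `Supp T I p S`: `S` is a support of the fact `p` relative to the instance `I`.
(S0) if `p ∈ I` then `{p}` is a support of `p`;
(S1) if `p ∉ I`, `(S,p)` is a TGD rule, and each `q ∈ S` has a support `f q`,
then the union of the `f q` is a support of `p`. -/
inductive Supp (T : Finset (Finset F × F)) (I : Finset F) : F → Finset F → Prop
  | base {p : F} (hp : p ∈ I) : Supp T I p {p}
  | step {p : F} {S : Finset F} (f : F → Finset F)
      (hp : p ∉ I) (hS : (S, p) ∈ T) (hf : ∀ q ∈ S, Supp T I q (f q)) :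
      Supp T I p (S.biUnion f)


/-- `Block T D I p B N`: `(B,N)` is a block of the fact `p` relative to the instance `I`.
(B0) if `p ∉ I` then `(∅,{p})` is a block of `p`;
(B1) if `p ∈ I`, `d` is a denial rule containing `p`, and every `q ∈ d∖{p}` has a
support `f q`, then `(⋃ f q, ∅)` is a block of `p`;
(B2) if `p ∈ I`, `(S,q)` is a TGD rule with `p ∈ S`, every `q' ∈ S∖{p}` has a support
`f q'`, and `(B,N)` is a block of `q`, then `(⋃ f q' ∪ B, N)` is a block of `p`. -/
inductive Block (T : Finset (Finset F × F)) (D : Finset (Finset F)) (I : Finset F) :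
    F → Finset F → Finset F → Prop
  | neg {p : F} (hp : p ∉ I) : Block T D I p ∅ {p}
  | denial {p : F} {d : Finset F} (f : F → Finset F)
      (hp : p ∈ I) (hd : d ∈ D) (hpd : p ∈ d)
      (hf : ∀ q ∈ d.erase p, Supp T I q (f q)) :
      Block T D I p ((d.erase p).biUnion f) ∅
  | tgd {p : F} {S : Finset F} {q : F} {B N : Finset F} (f : F → Finset F)
      (hp : p ∈ I) (hS : (S, q) ∈ T) (hpS : p ∈ S)
      (hf : ∀ q' ∈ S.erase p, Supp T I q' (f q'))
      (hB : Block T D I q B N) :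
      Block T D I p ((S.erase p).biUnion f ∪ B) N

section

variable {T : Finset (Finset F × F)} {D : Finset (Finset F)} {I I' : Finset F}

/-- A TGD-closed instance containing a support of a fact contains the fact. -/
theorem Supp.mem_of_subset (hI' : ∀ r ∈ T, r.1 ⊆ I' → r.2 ∈ I') {p : F} {S : Finset F}
    (h : Supp T I p S) (hS : S ⊆ I') : p ∈ I' := by
  induction h with
  | base hp => exact hS (Finset.mem_singleton_self _)
  | step f hp hr hf ih =>
    exact hI' _ hr fun q hq => ih q hq ((Finset.subset_biUnion_of_mem f hq).trans hS)

/-- A consistent instance satisfying a block of a fact omits the fact. -/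
theorem Block.notMem (hI' : DBConsistent T D I') {p : F} {B N : Finset F}
    (h : Block T D I p B N) (hB : B ⊆ I') (hN : N ∩ I' = ∅) : p ∉ I' := by
  induction h with
  | neg hp =>
    intro hmem
    exact Finset.notMem_empty _ (hN ▸ Finset.mem_inter.2 ⟨Finset.mem_singleton_self _, hmem⟩)
  | @denial p d f hp hd hpd hf =>
    intro hmem
    refine hI'.2 d hd fun q hq => ?_
    by_cases hqp : q = p
    · exact hqp ▸ hmem
    · have hq' : q ∈ d.erase p := Finset.mem_erase.2 ⟨hqp, hq⟩
      exact (hf q hq').mem_of_subset hI'.1 ((Finset.subset_biUnion_of_mem f hq').trans hB)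
  | @tgd p S q B N f hp hS hpS hf hb ih =>
    intro hmem
    refine ih (Finset.subset_union_right.trans hB) hN (hI'.1 _ hS fun q' hq => ?_)
    by_cases hqp : q' = p
    · exact hqp ▸ hmem
    · have hq' : q' ∈ S.erase p := Finset.mem_erase.2 ⟨hqp, hq⟩
      exact (hf q' hq').mem_of_subset hI'.1
        ((Finset.subset_biUnion_of_mem f hq').trans (Finset.subset_union_left.trans hB))

/-- Every fact of a repair has a support inside the repair. -/
theorem DBRepair.exists_supp (h : DBRepair T D I I') {p : F} (hp : p ∈ I') :
    ∃ S, Supp T I p S ∧ S ⊆ I' := by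
  classical
  by_contra hno
  refine h.2 ⟨I'.filter fun q => ∃ S, Supp T I q S ∧ S ⊆ I', ⟨?_, ?_⟩, ?_⟩
  · rintro ⟨S, q⟩ hr hS
    have hq : q ∈ I' := h.1.1 _ hr (hS.trans (Finset.filter_subset _ _))
    refine Finset.mem_filter.2 ⟨hq, ?_⟩
    by_cases hqI : q ∈ I
    · exact ⟨{q}, .base hqI, Finset.singleton_subset_iff.2 hq⟩
    · have hsupp : ∀ a, ∃ A, a ∈ S → Supp T I a A ∧ A ⊆ I' := fun a => by
        by_cases ha : a ∈ S
        · obtain ⟨A, hA⟩ := (Finset.mem_filter.1 (hS ha)).2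
          exact ⟨A, fun _ => hA⟩
        · exact ⟨∅, fun h => absurd h ha⟩
      choose f hf using hsupp
      exact ⟨S.biUnion f, .step f hqI hr fun a ha => (hf a ha).1,
        Finset.biUnion_subset.2 fun a ha => (hf a ha).2⟩
  · exact fun d hd hsub => h.1.2 d hd (hsub.trans (Finset.filter_subset _ _))
  · have hpI : p ∉ I := fun hpI =>
      hno ⟨{p}, .base hpI, Finset.singleton_subset_iff.2 hp⟩
    refine (Finset.ssubset_iff_of_subset fun a ha => ?_).2 ⟨p, ?_, ?_⟩
    · simp only [DBDelta, Finset.mem_union, Finset.mem_sdiff, Finset.mem_filter] at ha ⊢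
      rcases ha with ⟨haI, ha⟩ | ⟨ha, haI⟩
      · exact .inl ⟨haI, fun haI' =>
          ha ⟨haI', {a}, .base haI, Finset.singleton_subset_iff.2 haI'⟩⟩
      · exact .inr ⟨ha.1, haI⟩
    · simp [DBDelta, hp, hpI]
    · simp only [DBDelta, Finset.mem_union, Finset.mem_sdiff, Finset.mem_filter]
      rintro (⟨hpI', -⟩ | ⟨⟨-, hS⟩, -⟩)
      exacts [hpI hpI', hno hS]

/-- Adding back a fact deleted by a repair directly violates a denial rule or a TGD rule. -/
theorem DBRepair.exists_violation (h : DBRepair T D I I') {p : F} (hpI : p ∈ I) (hp : p ∉ I') :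
    (∃ d ∈ D, p ∈ d ∧ d.erase p ⊆ I') ∨
      ∃ r ∈ T, p ∈ r.1 ∧ r.1.erase p ⊆ I' ∧ r.2 ∉ I' := by
  by_contra! hno
  refine h.2 ⟨insert p I', ⟨fun r hr hS => ?_, fun d hd hsub => ?_⟩, ?_⟩
  · rw [Finset.subset_insert_iff] at hS
    refine Finset.mem_insert_of_mem ?_
    by_cases hpr : p ∈ r.1
    · exact hno.2 r hr hpr hS
    · exact h.1.1 r hr (by rwa [Finset.erase_eq_of_notMem hpr] at hS)
  · rw [Finset.subset_insert_iff] at hsub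
    by_cases hpd : p ∈ d
    · exact hno.1 d hd hpd hsub
    · exact h.1.2 d hd (by rwa [Finset.erase_eq_of_notMem hpd] at hsub)
  · refine (Finset.ssubset_iff_of_subset fun a ha => ?_).2 ⟨p, ?_, ?_⟩
    · simp only [DBDelta, Finset.mem_union, Finset.mem_sdiff, Finset.mem_insert] at ha ⊢
      grind
    · simp [DBDelta, hp, hpI]
    · simp [DBDelta, hpI]

/-- Every fact omitted by a repair has a block satisfied by the repair. -/
theorem DBRepair.exists_block (h : DBRepair T D I I') (rank : F → ℕ)
    (hacyc : ∀ r ∈ T, ∀ q ∈ r.1, rank q < rank r.2) {p : F} (hp : p ∉ I') :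
    ∃ B N : Finset F, Block T D I p B N ∧ B ⊆ I' ∧ N ∩ I' = ∅ := by
  have hsupp : ∀ a, ∃ A, a ∈ I' → Supp T I a A ∧ A ⊆ I' := fun a => by
    by_cases ha : a ∈ I'
    · obtain ⟨A, hA⟩ := h.exists_supp ha
      exact ⟨A, fun _ => hA⟩
    · exact ⟨∅, fun h => absurd h ha⟩
  choose f hf using hsupp
  induction hn : T.sup (fun r => rank r.2) - rank p using Nat.strong_induction_on
    generalizing p with
  | _ n ih =>
    by_cases hpI : p ∈ I
    · rcases h.exists_violation hpI hp with ⟨d, hd, hpd, hsub⟩ | ⟨⟨S, q⟩, hr, hpS, hsub, hq⟩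
      · exact ⟨_, _, .denial f hpI hd hpd fun a ha => (hf a (hsub ha)).1,
          Finset.biUnion_subset.2 fun a ha => (hf a (hsub ha)).2, Finset.empty_inter _⟩
      · have hlt : rank p < rank q := hacyc _ hr p hpS
        have hle : rank q ≤ T.sup (fun r => rank r.2) :=
          Finset.le_sup (f := fun r : Finset F × F => rank r.2) hr
        obtain ⟨B, N, hblock, hB, hN⟩ := ih _ (by omega) (p := q) hq rfl
        exact ⟨_, _, .tgd f hpI hr hpS (fun a ha => (hf a (hsub ha)).1) hblock,
          Finset.union_subset (Finset.biUnion_subset.2 fun a ha => (hf a (hsub ha)).2) hB, hN⟩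
    · exact ⟨∅, {p}, .neg hpI, Finset.empty_subset _, Finset.singleton_inter_of_notMem hp⟩

end

/-- Proposition (blocks): under the acyclicity assumption, for every repair `I'` of `I`
and every fact `p`, `p ∉ I'` iff some block `(B,N)` of `p` satisfies `B ⊆ I'` and
`N ∩ I' = ∅`. -/
theorem block_correct {R : Type*} (rel : F → R) (rk : R → ℕ)
    (T : Finset (Finset F × F)) (D : Finset (Finset F))
    (hT : ∀ r ∈ T, r.1.Nonempty) (hD : ∀ d ∈ D, d.Nonempty)
    (hacyc : ∀ r ∈ T, ∀ q ∈ r.1, rk (rel q) < rk (rel r.2))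
    (I I' : Finset F) (hrep : DBRepair T D I I') (p : F) :
    p ∉ I' ↔ ∃ B N : Finset F, Block T D I p B N ∧ B ⊆ I' ∧ N ∩ I' = ∅ := by
  exact ⟨fun hp => hrep.exists_block (fun a => rk (rel a)) hacyc hp,
    fun ⟨_, _, hblock, hB, hN⟩ => hblock.notMem hrep.1 hB hN⟩
end

section
/- Correctness of the 3-colorability reduction (main claim in the proof of Theorem 4 of the paper): With the instance I_G and the rule sets T and D constructed from the graph G as described, the graph G has a proper 3-coloring (an assignment f of one of 3 colors to each vertex such that adjacent vertices receive different colors) if and only if there exists a repair I' of I_G with r ∉ I'. -/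
/-!
Construction from a finite simple undirected graph with vertices `Fin n` and edges
`e j = {a j, b j}` for `j : Fin m` (no loops, no parallel edges, every vertex incident
to at least one edge). Facts are `p(i,j,k)` (vertex `i`, edge `j`, color `k`),
`q(j)` for `j ∈ {0,…,m}`, and `r`, `r'`, `r''`.
-/

/-- The type of facts of the reduction. -/
abbrev Fct (n m : ℕ) : Type := (Fin n × Fin m × Fin 3) ⊕ (Fin (m + 1) ⊕ Fin 3)

/-- The fact `p(i,j,k)`: vertex `vᵢ`, incident to edge `eⱼ`, has color `k`. -/
def pf {n m : ℕ} (i : Fin n) (j : Fin m) (k : Fin 3) : Fct n m := Sum.inl (i, j, k)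

/-- The fact `q(j)` for `j ∈ {0,…,m}`. -/
def qf {n m : ℕ} (j : Fin (m + 1)) : Fct n m := Sum.inr (Sum.inl j)

/-- The special fact `r`. -/
def rf {n m : ℕ} : Fct n m := Sum.inr (Sum.inr 0)

/-- The special fact `r'`. -/
def rf' {n m : ℕ} : Fct n m := Sum.inr (Sum.inr 1)

/-- The special fact `r''`. -/
def rf'' {n m : ℕ} : Fct n m := Sum.inr (Sum.inr 2)

variable {F : Type*} [DecidableEq F]

/-- The TGD rules: for every edge `eⱼ = {a j, b j}` and all distinct colors `k₁ ≠ k₂`,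
the rule `{p(a j, j, k₁), p(b j, j, k₂), q(j-1)} → q(j)`; and the rule
`{r, r', q(m)} → r''`. -/
def TG {n m : ℕ} (a b : Fin m → Fin n) : Finset (Finset (Fct n m) × Fct n m) :=
  ((Finset.univ : Finset (Fin m × Fin 3 × Fin 3)).filter fun x => x.2.1 ≠ x.2.2).image
    (fun x =>
      ({pf (a x.1) x.1 x.2.1, pf (b x.1) x.1 x.2.2, qf x.1.castSucc}, qf x.1.succ))
  ∪ {({rf, rf', qf (Fin.last m)}, rf'')}

/-- The denial rules: `{p(i,j₁,k₁), p(i,j₂,k₂)}` for every vertex `vᵢ`, all edges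
`eⱼ₁`, `eⱼ₂` incident to `vᵢ`, and all distinct colors `k₁ ≠ k₂`. -/
def DG {n m : ℕ} (a b : Fin m → Fin n) : Finset (Finset (Fct n m)) :=
  ((Finset.univ : Finset (Fin n × (Fin m × Fin m) × Fin 3 × Fin 3)).filter
      fun x => (a x.2.1.1 = x.1 ∨ b x.2.1.1 = x.1) ∧ (a x.2.1.2 = x.1 ∨ b x.2.1.2 = x.1) ∧
        x.2.2.1 ≠ x.2.2.2).image
    (fun x => {pf x.1 x.2.1.1 x.2.2.1, pf x.1 x.2.1.2 x.2.2.2})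

/-- The instance `I_G = { p(i,j,k) : vᵢ ∈ eⱼ, k ∈ {1,2,3} } ∪ { q(0), r, r' }`. -/
def IG {n m : ℕ} (a b : Fin m → Fin n) : Finset (Fct n m) :=
  (((Finset.univ : Finset (Fin n × Fin m × Fin 3)).filter
      fun x => a x.2.1 = x.1 ∨ b x.2.1 = x.1).image fun x => pf x.1 x.2.1 x.2.2)
  ∪ {qf 0, rf, rf'}

theorem dbConsistent_iff {n m : ℕ} (a b : Fin m → Fin n) (J : Finset (Fct n m)) :
    DBConsistent (TG a b) (DG a b) J ↔
      (∀ j k₁ k₂, k₁ ≠ k₂ → pf (a j) j k₁ ∈ J → pf (b j) j k₂ ∈ J → qf j.castSucc ∈ J →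
        qf j.succ ∈ J) ∧
      (rf ∈ J → rf' ∈ J → qf (Fin.last m) ∈ J → rf'' ∈ J) ∧
      ∀ i j₁ j₂ k₁ k₂, (a j₁ = i ∨ b j₁ = i) → (a j₂ = i ∨ b j₂ = i) →
        pf i j₁ k₁ ∈ J → pf i j₂ k₂ ∈ J → k₁ = k₂ := by
  constructor
  · rintro ⟨hT, hD⟩
    refine ⟨fun j k₁ k₂ hk h₁ h₂ h₃ => ?_, fun h₁ h₂ h₃ => ?_,
      fun i j₁ j₂ k₁ k₂ hj₁ hj₂ h₁ h₂ => ?_⟩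
    · refine hT (_, _) (Finset.mem_union_left _ (Finset.mem_image.2 ⟨(j, k₁, k₂), ?_, rfl⟩)) ?_
      · simpa using hk
      · simp [Finset.insert_subset_iff, h₁, h₂, h₃]
    · refine hT (_, _) (Finset.mem_union_right _ (Finset.mem_singleton_self _)) ?_
      simp [Finset.insert_subset_iff, h₁, h₂, h₃]
    · by_contra hk
      refine hD _ (Finset.mem_image.2 ⟨(i, (j₁, j₂), k₁, k₂), ?_, rfl⟩) ?_
      · simp [hj₁, hj₂, hk]
      · simp [Finset.insert_subset_iff, h₁, h₂]
  · rintro ⟨hE, hR, hC⟩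
    refine ⟨fun r hr hs => ?_, fun d hd hs => ?_⟩
    · rcases Finset.mem_union.1 hr with hr | hr
      · obtain ⟨⟨j, k₁, k₂⟩, hk, rfl⟩ := Finset.mem_image.1 hr
        simp only [Finset.insert_subset_iff, Finset.singleton_subset_iff] at hs
        exact hE j k₁ k₂ (Finset.mem_filter.1 hk).2 hs.1 hs.2.1 hs.2.2
      · obtain rfl := Finset.mem_singleton.1 hr
        simp only [Finset.insert_subset_iff, Finset.singleton_subset_iff] at hs
        exact hR hs.1 hs.2.1 hs.2.2
    · obtain ⟨⟨i, ⟨j₁, j₂⟩, k₁, k₂⟩, hk, rfl⟩ := Finset.mem_image.1 hd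
      simp only [Finset.insert_subset_iff, Finset.singleton_subset_iff] at hs
      obtain ⟨hj₁, hj₂, hk⟩ := (Finset.mem_filter.1 hk).2
      exact hk (hC i j₁ j₂ k₁ k₂ hj₁ hj₂ hs.1 hs.2)

theorem mem_dbDelta {I J : Finset F} {x : F} :
    x ∈ DBDelta I J ↔ ¬ (x ∈ I ↔ x ∈ J) := by
  simp only [DBDelta, Finset.mem_union, Finset.mem_sdiff]
  tauto

theorem pf_mem_IG {n m : ℕ} {a b : Fin m → Fin n} {i : Fin n} {j : Fin m} {k : Fin 3} :
    pf i j k ∈ IG a b ↔ a j = i ∨ b j = i := by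
  simp [IG, pf, qf, rf, rf']

theorem qf_mem_IG {n m : ℕ} {a b : Fin m → Fin n} {j : Fin (m + 1)} :
    qf j ∈ IG a b ↔ j = 0 := by
  simp [IG, pf, qf, rf, rf']

theorem rf_mem_IG {n m : ℕ} {a b : Fin m → Fin n} : rf ∈ IG a b := by
  simp [IG]

theorem rf'_mem_IG {n m : ℕ} {a b : Fin m → Fin n} : rf' ∈ IG a b := by
  simp [IG]

theorem rf''_not_mem_IG {n m : ℕ} {a b : Fin m → Fin n} : rf'' ∉ IG a b := by
  simp [IG, pf, qf, rf, rf', rf'']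

/-- The instance encoding a coloring `f`: each `p(i,j,·)` gets the color `f i`, all `q(j)` are
present, and `r` is deleted. -/
def coloringInstance {n m : ℕ} (a b : Fin m → Fin n) (f : Fin n → Fin 3) : Finset (Fct n m) :=
  (Finset.univ.filter fun x : Fin n × Fin m × Fin 3 =>
    (a x.2.1 = x.1 ∨ b x.2.1 = x.1) ∧ x.2.2 = f x.1).disjSum (Finset.univ.disjSum {1})

section coloringInstance

variable {n m : ℕ} {a b : Fin m → Fin n} {f : Fin n → Fin 3}

theorem pf_mem_coloringInstance {i : Fin n} {j : Fin m} {k : Fin 3} :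
    pf i j k ∈ coloringInstance a b f ↔ (a j = i ∨ b j = i) ∧ k = f i := by
  simp [coloringInstance, pf]

theorem qf_mem_coloringInstance {j : Fin (m + 1)} : qf j ∈ coloringInstance a b f := by
  simp [coloringInstance, qf]

theorem rf_not_mem_coloringInstance : rf ∉ coloringInstance a b f := by
  simp [coloringInstance, rf]

theorem rf'_mem_coloringInstance : rf' ∈ coloringInstance a b f := by
  simp [coloringInstance, rf']

theorem rf''_not_mem_coloringInstance : rf'' ∉ coloringInstance a b f := by
  simp [coloringInstance, rf'']

theorem dbConsistent_coloringInstance :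
    DBConsistent (TG a b) (DG a b) (coloringInstance a b f) := by
  refine (dbConsistent_iff a b _).2 ⟨fun _ _ _ _ _ _ _ => qf_mem_coloringInstance,
    fun h => (rf_not_mem_coloringInstance h).elim, fun i j₁ j₂ k₁ k₂ _ _ h₁ h₂ => ?_⟩
  rw [(pf_mem_coloringInstance.1 h₁).2, (pf_mem_coloringInstance.1 h₂).2]

theorem dbRepair_coloringInstance (hf : ∀ j, f (a j) ≠ f (b j)) :
    DBRepair (TG a b) (DG a b) (IG a b) (coloringInstance a b f) := by
  refine ⟨dbConsistent_coloringInstance, ?_⟩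
  rintro ⟨J, hJ, hsub, hne⟩
  obtain ⟨hE, hR, hC⟩ := (dbConsistent_iff a b J).1 hJ
  have agree : ∀ x, (x ∈ IG a b ↔ x ∈ coloringInstance a b f) → (x ∈ IG a b ↔ x ∈ J) := by
    intro x hx
    by_contra h
    exact mem_dbDelta.1 (hsub (mem_dbDelta.2 h)) hx
  have hp : ∀ i j, (a j = i ∨ b j = i) → pf i j (f i) ∈ J := fun i j h =>
    (agree _ (iff_of_true (pf_mem_IG.2 h) (pf_mem_coloringInstance.2 ⟨h, rfl⟩))).1
      (pf_mem_IG.2 h)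
  have hq : ∀ j, qf j ∈ J := by
    intro j
    induction j using Fin.induction with
    | zero =>
      exact (agree _ (iff_of_true (qf_mem_IG.2 rfl) qf_mem_coloringInstance)).1 (qf_mem_IG.2 rfl)
    | succ j ih =>
      exact hE j _ _ (hf j) (hp _ j (.inl rfl)) (hp _ j (.inr rfl)) ih
  have hr' : rf' ∈ J :=
    (agree _ (iff_of_true rf'_mem_IG rf'_mem_coloringInstance)).1 rf'_mem_IG
  have hr'' : rf'' ∉ J := fun h =>
    rf''_not_mem_IG ((agree _ (iff_of_false rf''_not_mem_IG rf''_not_mem_coloringInstance)).2 h)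
  have hr : rf ∉ J := fun h => hr'' (hR h hr' (hq _))
  refine hne fun x hx => ?_
  rw [mem_dbDelta] at hx ⊢
  suffices x ∈ J ↔ x ∈ coloringInstance a b f by rwa [this]
  rcases x with ⟨i, j, k⟩ | j | k
  · change pf i j k ∈ J ↔ pf i j k ∈ _
    rw [pf_mem_coloringInstance]
    constructor
    · intro h
      have hij : a j = i ∨ b j = i := by
        by_contra hij
        exact hij (pf_mem_IG.1 ((agree _ (iff_of_false (mt pf_mem_IG.1 hij)
          (mt (fun h => (pf_mem_coloringInstance.1 h).1) hij))).2 h))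
      exact ⟨hij, hC i j j k (f i) hij hij h (hp i j hij)⟩
    · rintro ⟨hij, rfl⟩
      exact hp i j hij
  · exact iff_of_true (hq j) qf_mem_coloringInstance
  · fin_cases k
    · exact iff_of_false hr rf_not_mem_coloringInstance
    · exact iff_of_true hr' rf'_mem_coloringInstance
    · exact iff_of_false hr'' rf''_not_mem_coloringInstance

end coloringInstance

/-- In a repair without `r`, the rule of every edge fires on the `p`-facts: otherwise one could
drop all later `q`-facts and restore `r`. -/
theorem exists_ne_colors_of_dbRepair {n m : ℕ} {a b : Fin m → Fin n} {I' : Finset (Fct n m)}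
    (hI : DBRepair (TG a b) (DG a b) (IG a b) I') (hr : rf ∉ I') (j : Fin m) :
    ∃ k₁ k₂, k₁ ≠ k₂ ∧ pf (a j) j k₁ ∈ I' ∧ pf (b j) j k₂ ∈ I' := by
  by_contra! hj
  obtain ⟨hcons, hmin⟩ := hI
  obtain ⟨hE, hR, hC⟩ := (dbConsistent_iff a b I').1 hcons
  set J : Finset (Fct n m) :=
    insert rf (I' \ (Finset.univ.filter fun l => j.castSucc < l).image qf) with hJ
  have hJp : ∀ i l k, pf i l k ∈ J ↔ pf i l k ∈ I' := by
    intro i l k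
    simp [hJ, pf, rf, qf]
  have hJq : ∀ l, qf l ∈ J ↔ qf l ∈ I' ∧ l ≤ j.castSucc := by
    intro l
    simp [hJ, rf, qf]
  have hJr : ∀ k : Fin 3, (Sum.inr (Sum.inr k) : Fct n m) ∈ J ↔
      k = 0 ∨ (Sum.inr (Sum.inr k) : Fct n m) ∈ I' := by
    intro k
    simp [hJ, rf, qf]
  refine hmin ⟨J, (dbConsistent_iff a b J).2 ⟨?_, ?_, ?_⟩, ?_⟩
  · intro l k₁ k₂ hk h₁ h₂ h₃
    rw [hJp] at h₁ h₂
    rw [hJq] at h₃ ⊢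
    refine ⟨hE l k₁ k₂ hk h₁ h₂ h₃.1, ?_⟩
    rcases eq_or_ne l j with rfl | hlj
    · exact (hj k₁ k₂ hk h₁ h₂).elim
    · have h := h₃.2
      simp only [Fin.le_def, Fin.val_castSucc, Fin.val_succ, ne_eq, Fin.ext_iff] at h hlj ⊢
      omega
  · intro _ _ h
    have h := ((hJq _).1 h).2
    simp only [Fin.le_def, Fin.val_castSucc, Fin.val_last] at h
    omega
  · intro i j₁ j₂ k₁ k₂ hj₁ hj₂ h₁ h₂
    exact hC i j₁ j₂ k₁ k₂ hj₁ hj₂ ((hJp _ _ _).1 h₁) ((hJp _ _ _).1 h₂)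
  · rw [Finset.ssubset_iff_of_subset]
    · refine ⟨rf, mem_dbDelta.2 fun h => hr (h.1 rf_mem_IG), fun h => ?_⟩
      exact mem_dbDelta.1 h (iff_of_true rf_mem_IG (Finset.mem_insert_self _ _))
    · intro x hx
      rw [mem_dbDelta] at hx ⊢
      rcases x with ⟨i, l, k⟩ | l | k
      · exact fun h => hx (h.trans (hJp i l k).symm)
      · change ¬ (qf l ∈ _ ↔ qf l ∈ _) at hx
        change ¬ (qf l ∈ _ ↔ qf l ∈ _)
        rw [qf_mem_IG] at hx ⊢
        rw [hJq] at hx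
        rintro h
        refine hx ⟨fun hl => ⟨h.1 hl, hl ▸ Fin.zero_le _⟩, fun hl => h.2 hl.1⟩
      · rw [hJr] at hx
        intro h
        rcases eq_or_ne k 0 with rfl | hk
        · exact hx (iff_of_true rf_mem_IG (.inl rfl))
        · exact hx (by simpa [hk] using h)

/-- Correctness of the 3-colorability reduction: `G` has a proper 3-coloring iff there
is a repair `I'` of `I_G` with `r ∉ I'`. -/
theorem three_colorability_reduction (n m : ℕ) (a b : Fin m → Fin n)
    (hloops : ∀ j : Fin m, a j ≠ b j)
    (hsimple : ∀ j j' : Fin m,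
      ({a j, b j} : Finset (Fin n)) = ({a j', b j'} : Finset (Fin n)) → j = j')
    (hcov : ∀ i : Fin n, ∃ j : Fin m, a j = i ∨ b j = i) :
    (∃ f : Fin n → Fin 3, ∀ j : Fin m, f (a j) ≠ f (b j)) ↔
      ∃ I' : Finset (Fct n m), DBRepair (TG a b) (DG a b) (IG a b) I' ∧ rf ∉ I' := by
  constructor
  · rintro ⟨f, hf⟩
    exact ⟨coloringInstance a b f, dbRepair_coloringInstance hf, rf_not_mem_coloringInstance⟩
  · rintro ⟨I', hI, hr⟩
    have hC := ((dbConsistent_iff a b I').1 hI.1).2.2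
    have hcolor : ∀ i, ∃ c, ∀ j k, (a j = i ∨ b j = i) → pf i j k ∈ I' → k = c := by
      intro i
      by_cases h : ∃ j k, (a j = i ∨ b j = i) ∧ pf i j k ∈ I'
      · obtain ⟨j₀, c, hj₀, hc⟩ := h
        exact ⟨c, fun j k hj hk => hC i j j₀ k c hj hj₀ hk hc⟩
      · exact ⟨0, fun j k hj hk => (h ⟨j, k, hj, hk⟩).elim⟩
    choose f hf using hcolor
    refine ⟨f, fun j => ?_⟩
    obtain ⟨k₁, k₂, hk, h₁, h₂⟩ := exists_ne_colors_of_dbRepair hI hr j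
    rwa [← hf _ j k₁ (.inl rfl) h₁, ← hf _ j k₂ (.inr rfl) h₂]
end
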